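/- Second eigenvalue and faster convergence for larger k (Theorem 2): for a single action coordinate I = {(i, i)}, λ_{k,I} = (n − 1)/n, independent of k; for a single link coordinate I = {(i, j)} with i > j, λ_{k,I} = 1 − 2(k − 1)/(n(n − 1)), which is strictly decreasing in k on 2 ≤ k ≤ n. Consequently, for 2 ≤ k < k' ≤ n and every set I containing a link coordinate (i, j) with i > j such that I_{i} = {j} and I_{j} = {i}, one has λ_{k',I} ≤ λ_{k,I}, so the k'-player consensual dynamic contracts the corresponding eigenfunctions at least as fast as the k-player dynamic, strictly faster on single-link eigenfunctions. -/

import Mathlib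

open Finset

namespace NEkSN

/-- A network state: a profile of binary actions together with a symmetric,
loopless adjacency matrix of friendship links. -/
abbrev NetState (n : ℕ) :=
  {S : (Fin n → Bool) × (Fin n → Fin n → Bool) //
    (∀ i j, S.2 i j = S.2 j i) ∧ ∀ i, S.2 i i = false}

variable {n : ℕ}

noncomputable section

/-- The (real-valued) action of agent `i`. -/
def act (S : NetState n) (i : Fin n) : ℝ := if S.1.1 i then 1 else 0

/-- The (real-valued) link indicator between `i` and `j`. -/
def lnk (S : NetState n) (i j : Fin n) : ℝ := if S.1.2 i j then 1 else 0

/-- Agent `i`'s utility. -/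
def util (v : Fin n → ℝ) (w : Fin n → Fin n → ℝ) (q : Fin n → Fin n → Fin n → ℝ)
    (h φ : ℝ) (i : Fin n) (S : NetState n) : ℝ :=
  act S i * v i
    + ∑ j ∈ univ.erase i, lnk S i j * w i j
    + ∑ j ∈ univ.erase i, ∑ k ∈ univ.erase i,
        (if j < k then q i j k * lnk S i j * lnk S j k * lnk S k i else 0)
    + h * act S i * ∑ j ∈ univ.erase i, act S j
    + φ * ∑ j ∈ univ.erase i,
        lnk S i j * (act S i * act S j + (1 - act S i) * (1 - act S j))

/-- The potential function. -/
def potential (v : Fin n → ℝ) (w : Fin n → Fin n → ℝ) (q : Fin n → Fin n → Fin n → ℝ)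
    (h φ : ℝ) (S : NetState n) : ℝ :=
  (∑ i, act S i * v i)
    + (1 / 2) * ∑ i, ∑ j ∈ univ.erase i, lnk S i j * w i j
    + (h / 2) * ∑ i, ∑ j ∈ univ.erase i, act S i * act S j
    + (φ / 2) * ∑ i, ∑ j ∈ univ.erase i,
        lnk S i j * (act S i * act S j + (1 - act S i) * (1 - act S j))
    + ∑ i, ∑ j, ∑ k, (if i < j ∧ j < k then q i j k * lnk S i j * lnk S j k * lnk S k i else 0)

/-- The state `S` with `i`'s action set to `b`. -/
def setAct (S : NetState n) (i : Fin n) (b : Bool) : NetState n :=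
  ⟨(Function.update S.1.1 i b, S.1.2), S.2⟩

/-- The state `S` with the link between `i` and `j` (`i ≠ j`) set to `b`. -/
def setLink (S : NetState n) (i j : Fin n) (b : Bool) : NetState n :=
  ⟨(S.1.1, fun p q =>
      if p = q then false
      else if (p = i ∧ q = j) ∨ (p = j ∧ q = i) then b else S.1.2 p q), by
    refine ⟨fun p q => ?_, fun p => ?_⟩
    · by_cases hpq : p = q
      · simp [hpq]
      · have hqp : ¬q = p := fun hc => hpq hc.symm
        simp only [if_neg hpq, if_neg hqp]
        by_cases hc : (p = i ∧ q = j) ∨ (p = j ∧ q = i)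
        · rw [if_pos hc, if_pos (by tauto)]
        · rw [if_neg hc, if_neg (by tauto), S.2.1 p q]
    · simp⟩

/-- The state `S` with all links between `i` and members of `D` deleted. -/
def deleteLinks (S : NetState n) (i : Fin n) (D : Finset (Fin n)) : NetState n :=
  ⟨(S.1.1, fun p q => if (p = i ∧ q ∈ D) ∨ (q = i ∧ p ∈ D) then false else S.1.2 p q), by
    refine ⟨fun p q => ?_, fun p => ?_⟩
    · dsimp only
      by_cases hc : (p = i ∧ q ∈ D) ∨ (q = i ∧ p ∈ D)
      · rw [if_pos hc, if_pos (by tauto)]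
      · rw [if_neg hc, if_neg (by tauto), S.2.1 p q]
    · dsimp only
      split
      · rfl
      · exact S.2.2 p⟩

/-- Incremental utility of agent `i` from switching her action on. -/
def dActU (v : Fin n → ℝ) (w : Fin n → Fin n → ℝ) (q : Fin n → Fin n → Fin n → ℝ)
    (h φ : ℝ) (i : Fin n) (S : NetState n) : ℝ :=
  util v w q h φ i (setAct S i true) - util v w q h φ i (setAct S i false)

/-- Incremental potential from switching `i`'s action on. -/
def dActP (v : Fin n → ℝ) (w : Fin n → Fin n → ℝ) (q : Fin n → Fin n → Fin n → ℝ)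
    (h φ : ℝ) (i : Fin n) (S : NetState n) : ℝ :=
  potential v w q h φ (setAct S i true) - potential v w q h φ (setAct S i false)

/-- Incremental utility of agent `i` from the link with `j`. -/
def dLinkU (v : Fin n → ℝ) (w : Fin n → Fin n → ℝ) (q : Fin n → Fin n → Fin n → ℝ)
    (h φ : ℝ) (i j : Fin n) (S : NetState n) : ℝ :=
  util v w q h φ i (setLink S i j true) - util v w q h φ i (setLink S i j false)

/-- Incremental potential from the link between `i` and `j`. -/
def dLinkP (v : Fin n → ℝ) (w : Fin n → Fin n → ℝ) (q : Fin n → Fin n → Fin n → ℝ)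
    (h φ : ℝ) (i j : Fin n) (S : NetState n) : ℝ :=
  potential v w q h φ (setLink S i j true) - potential v w q h φ (setLink S i j false)

/-- A `k`-meeting: an agent `i` together with a set of `k - 1` other agents. -/
abbrev Meeting (n k : ℕ) :=
  {μ : Fin n × Finset (Fin n) // μ.1 ∉ μ.2 ∧ μ.2.card = k - 1}

/-- The `k`-neighborhood of `S` for meeting `μ = (i, I)`: all states agreeing with `S`
except possibly in `i`'s action and the links between `i` and members of `I`. -/
def nbhd {k : ℕ} (μ : Meeting n k) (S : NetState n) : Finset (NetState n) :=
  univ.filter fun S' =>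
    (∀ p, p ≠ μ.1.1 → S'.1.1 p = S.1.1 p) ∧
    (∀ p q, ¬((p = μ.1.1 ∧ q ∈ μ.1.2) ∨ (q = μ.1.1 ∧ p ∈ μ.1.2)) → S'.1.2 p q = S.1.2 p q)

/-- The feasible set for the decision problem of `μ.1` on the neighborhood of `S`:
states in the neighborhood satisfying the stability constraints. -/
def feasible (v : Fin n → ℝ) (w : Fin n → Fin n → ℝ) (q : Fin n → Fin n → Fin n → ℝ)
    (h φ : ℝ) {k : ℕ} (μ : Meeting n k) (S : NetState n) : Set (NetState n) :=
  {S' | S' ∈ nbhd μ S ∧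
    ∀ j ∈ μ.1.2, S'.1.2 μ.1.1 j = true → 0 ≤ dLinkU v w q h φ j μ.1.1 S'}

/-- Nash equilibrium in a `k`(-player) stable network. -/
def isNEkSN (v : Fin n → ℝ) (w : Fin n → Fin n → ℝ) (q : Fin n → Fin n → Fin n → ℝ)
    (h φ : ℝ) (k : ℕ) (S : NetState n) : Prop :=
  ∀ μ : Meeting n k,
    S ∈ feasible v w q h φ μ S ∧
    ∀ T ∈ feasible v w q h φ μ S, util v w q h φ μ.1.1 T ≤ util v w q h φ μ.1.1 S

/-- One-step transition kernel of the `k`-player consensual dynamic with logit shocks: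
`kernel … ρ S' S = P_k(S' | S)`. -/
def kernel (v : Fin n → ℝ) (w : Fin n → Fin n → ℝ) (q : Fin n → Fin n → Fin n → ℝ)
    (h φ : ℝ) (k : ℕ) (ρ : Meeting n k → ℝ) (S' S : NetState n) : ℝ :=
  ∑ μ : Meeting n k,
    if S' ∈ nbhd μ S then
      ρ μ * Real.exp (potential v w q h φ S') /
        ∑ T ∈ nbhd μ S, Real.exp (potential v w q h φ T)
    else 0

/-- The Gibbs (stationary) distribution `π(S) ∝ exp (Φ S)`. -/
def gibbs (v : Fin n → ℝ) (w : Fin n → Fin n → ℝ) (q : Fin n → Fin n → Fin n → ℝ)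
    (h φ : ℝ) (S : NetState n) : ℝ :=
  Real.exp (potential v w q h φ S) / ∑ T : NetState n, Real.exp (potential v w q h φ T)

/-- `m`-step transition probabilities of the `k`CD. -/
def kernelIter (v : Fin n → ℝ) (w : Fin n → Fin n → ℝ) (q : Fin n → Fin n → Fin n → ℝ)
    (h φ : ℝ) (k : ℕ) (ρ : Meeting n k → ℝ) : ℕ → NetState n → NetState n → ℝ
  | 0, S', S => if S' = S then 1 else 0
  | m + 1, S', S =>
      ∑ T : NetState n, kernel v w q h φ k ρ S' T * kernelIter v w q h φ k ρ m T S

/-- The eigenfunction `e_I` associated with a set `I` of coordinate pairs `(i, j)`, `i ≥ j`: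
`(i, i)` refers to the action `a_i` and `(i, j)` with `i > j` to the link `g_{ij}`. -/
def eig (I : Finset (Fin n × Fin n)) (S : NetState n) : ℝ :=
  ∏ p ∈ I,
    if p.1 = p.2 then (if S.1.1 p.1 then (-1 : ℝ) else 1)
    else (if S.1.2 p.1 p.2 then (-1 : ℝ) else 1)

/-- `I_i = {j ≠ i : (i, j) ∈ I or (j, i) ∈ I}`. -/
def linkedSet (I : Finset (Fin n × Fin n)) (i : Fin n) : Finset (Fin n) :=
  univ.filter fun j => j ≠ i ∧ ((i, j) ∈ I ∨ (j, i) ∈ I)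

/-- The eigenvalue `λ_{k,I}`. -/
def lam (k : ℕ) (I : Finset (Fin n × Fin n)) : ℝ :=
  (∑ i ∈ univ.filter (fun i : Fin n => (i, i) ∉ I),
      ((n - 1 - (linkedSet I i).card).choose (k - 1) : ℝ))
    / (n * ((n - 1).choose (k - 1) : ℝ))

/-- The one-flip neighborhood `N(S)`: states obtained from `S` by flipping exactly one
coordinate (one action or one link). -/
def flipNbhd (S : NetState n) : Set (NetState n) :=
  {S' | (∃ i, S' = setAct S i (!S.1.1 i)) ∨
        ∃ i j, i ≠ j ∧ S' = setLink S i j (!S.1.2 i j)}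

end



/-- The ratio `C(m, r) / C(N, r)` decreases with one step of `r`. -/
lemma choose_ratio_step (m N r : ℕ) (hm : m ≤ N) :
    m.choose (r + 1) * N.choose r ≤ m.choose r * N.choose (r + 1) := by
  have h1 := Nat.choose_succ_right_eq m r
  have h2 := Nat.choose_succ_right_eq N r
  have h3 : m - r ≤ N - r := by omega
  refine Nat.le_of_mul_le_mul_right (c := r + 1) ?_ (Nat.succ_pos r)
  calc m.choose (r + 1) * N.choose r * (r + 1)
      = (m.choose (r + 1) * (r + 1)) * N.choose r := by ring
    _ = m.choose r * N.choose r * (m - r) := by rw [h1]; ring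
    _ ≤ m.choose r * N.choose r * (N - r) := Nat.mul_le_mul_left _ h3
    _ = m.choose r * (N.choose (r + 1) * (r + 1)) := by rw [h2]; ring
    _ = m.choose r * N.choose (r + 1) * (r + 1) := by ring

lemma choose_ratio_anti (m N r r' : ℕ) (hm : m ≤ N) (hr : r ≤ r') (hN : r' ≤ N) :
    (m.choose r' : ℝ) / N.choose r' ≤ (m.choose r : ℝ) / N.choose r := by
  induction r', hr using Nat.le_induction with
  | base => exact le_rfl
  | succ s hs ih =>
    refine le_trans ?_ (ih (by omega))
    have p1 : (0 : ℝ) < N.choose s := by exact_mod_cast Nat.choose_pos (by omega)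
    have p2 : (0 : ℝ) < N.choose (s + 1) := by exact_mod_cast Nat.choose_pos hN
    rw [div_le_div_iff₀ p2 p1]
    exact_mod_cast choose_ratio_step m N s hm

lemma lam_eq (k : ℕ) (I : Finset (Fin n × Fin n)) :
    lam k I = (∑ i ∈ univ.filter (fun i : Fin n => (i, i) ∉ I),
      ((n - 1 - (linkedSet I i).card).choose (k - 1) : ℝ) / ((n - 1).choose (k - 1) : ℝ)) / n := by
  unfold lam
  rw [← Finset.sum_div, div_div, mul_comm]

lemma lam_anti (k k' : ℕ) (hk : k ≤ k') (hn : k' ≤ n) (I : Finset (Fin n × Fin n)) :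
    lam k' I ≤ lam k I := by
  rw [lam_eq, lam_eq]
  refine div_le_div_of_nonneg_right (Finset.sum_le_sum fun i _ => ?_) (Nat.cast_nonneg n)
  exact choose_ratio_anti _ _ _ _ (Nat.sub_le _ _) (by omega) (by omega)

lemma lam_action (k : ℕ) (hk : k ≤ n) (hn : 2 ≤ n) (i : Fin n) :
    lam k ({(i, i)} : Finset (Fin n × Fin n)) = ((n : ℝ) - 1) / n := by
  have hc : ((n - 1).choose (k - 1) : ℝ) ≠ 0 := by
    exact_mod_cast (Nat.choose_pos (by omega)).ne'
  have hl : ∀ a : Fin n, linkedSet ({(i, i)} : Finset (Fin n × Fin n)) a = ∅ := by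
    intro a
    ext b
    simp only [linkedSet, mem_filter, mem_univ, true_and, mem_singleton, Prod.mk.injEq,
      notMem_empty, iff_false]
    grind
  have hf : univ.filter (fun a : Fin n => (a, a) ∉ ({(i, i)} : Finset (Fin n × Fin n)))
      = univ.erase i := by
    ext a; simp
  rw [lam_eq, hf]
  simp only [hl, card_empty, Nat.sub_zero, div_self hc]
  rw [Finset.sum_const, Finset.card_erase_of_mem (mem_univ i), Finset.card_univ, Fintype.card_fin,
    nsmul_eq_mul, mul_one, Nat.cast_sub (by omega), Nat.cast_one]

lemma lam_link (k : ℕ) (hk1 : 1 < k) (hk : k ≤ n) (i j : Fin n) (hij : j < i) :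
    lam k ({(i, j)} : Finset (Fin n × Fin n)) =
      1 - 2 * ((k : ℝ) - 1) / ((n : ℝ) * ((n : ℝ) - 1)) := by
  obtain ⟨N, rfl⟩ : ∃ N, n = N + 2 := ⟨n - 2, by omega⟩
  obtain ⟨r, rfl⟩ : ∃ r, k = r + 1 := ⟨k - 1, by omega⟩
  have hne : i ≠ j := ne_of_gt hij
  have hc : ((N + 1).choose r : ℝ) ≠ 0 := by
    exact_mod_cast (Nat.choose_pos (by omega)).ne'
  have hl : ∀ a : Fin (N + 2), (linkedSet ({(i, j)} : Finset (Fin (N + 2) × Fin (N + 2))) a).card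
      = if a = i ∨ a = j then 1 else 0 := by
    intro a
    by_cases h1 : a = i
    · have : linkedSet ({(i, j)} : Finset (Fin (N + 2) × Fin (N + 2))) a = {j} := by
        ext b
        simp only [linkedSet, mem_filter, mem_univ, true_and, mem_singleton, Prod.mk.injEq]
        grind
      rw [this]; simp [h1]
    by_cases h2 : a = j
    · have : linkedSet ({(i, j)} : Finset (Fin (N + 2) × Fin (N + 2))) a = {i} := by
        ext b
        simp only [linkedSet, mem_filter, mem_univ, true_and, mem_singleton, Prod.mk.injEq]
        grind
      rw [this]; simp [h2]
    · have : linkedSet ({(i, j)} : Finset (Fin (N + 2) × Fin (N + 2))) a = ∅ := by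
        ext b
        simp only [linkedSet, mem_filter, mem_univ, true_and, mem_singleton, Prod.mk.injEq,
          notMem_empty, iff_false]
        grind
      simp [this, h1, h2]
  have hf : univ.filter (fun a : Fin (N + 2) =>
      (a, a) ∉ ({(i, j)} : Finset (Fin (N + 2) × Fin (N + 2)))) = univ := by
    ext a
    simp only [mem_filter, mem_univ, true_and, mem_singleton, Prod.mk.injEq, iff_true]
    grind
  have hratio : ((N.choose r : ℝ)) / (N + 1).choose r = 1 - r / (N + 1) := by
    have h := Nat.choose_mul_succ_eq N r
    have h' : (N.choose r : ℝ) * (N + 1) = (N + 1).choose r * (N + 1 - r) := by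
      have : ((N + 1 - r : ℕ) : ℝ) = N + 1 - r := by
        rw [Nat.cast_sub (by omega)]; push_cast; ring
      rw [← this]; exact_mod_cast h
    have hN : (N + 1 : ℝ) ≠ 0 := by positivity
    field_simp
    linarith
  have hs : ∀ a : Fin (N + 2), (((N + 2 - 1 - (linkedSet
      ({(i, j)} : Finset (Fin (N + 2) × Fin (N + 2))) a).card).choose (r + 1 - 1) : ℕ) : ℝ)
        / ((N + 2 - 1).choose (r + 1 - 1) : ℝ)
      = 1 - (if a = i then (r / (N + 1) : ℝ) else 0) - (if a = j then (r / (N + 1) : ℝ) else 0) := by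
    intro a
    rw [hl]
    have e1 : N + 2 - 1 = N + 1 := rfl
    have e2 : r + 1 - 1 = r := rfl
    rw [e1, e2]
    by_cases h1 : a = i
    · simp [h1, hne, hratio]
    by_cases h2 : a = j
    · simp [h2, hne.symm, hratio]
    · simp [h1, h2, hc]
  rw [lam_eq, hf, Finset.sum_congr rfl fun a _ => hs a]
  rw [Finset.sum_sub_distrib, Finset.sum_sub_distrib]
  simp only [Finset.sum_ite_eq', mem_univ, if_true, Finset.sum_const, Finset.card_univ,
    Fintype.card_fin, nsmul_eq_mul]
  push_cast
  have hN : (N + 1 : ℝ) ≠ 0 := by positivity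
  have hN2 : (N + 2 : ℝ) ≠ 0 := by positivity
  have e : (N + 2 - 1 : ℝ) = N + 1 := by ring
  rw [e]
  field_simp
  ring

/-- Theorem 2: `λ_{k,{(i,i)}} = (n−1)/n`;
`λ_{k,{(i,j)}} = 1 − 2(k−1)/(n(n−1))` for a link coordinate, strictly decreasing in `k`;
and for any `I` containing a link coordinate `(i,j)` with `I_i = {j}` and `I_j = {i}`,
`λ_{k',I} ≤ λ_{k,I}` whenever `2 ≤ k < k' ≤ n`. -/
theorem lam_single_coordinates {n : ℕ} (hn : 2 ≤ n) :
    (∀ k : ℕ, 1 < k → k ≤ n → ∀ i : Fin n,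
        lam k ({(i, i)} : Finset (Fin n × Fin n)) = ((n : ℝ) - 1) / n) ∧
    (∀ k : ℕ, 1 < k → k ≤ n → ∀ i j : Fin n, j < i →
        lam k ({(i, j)} : Finset (Fin n × Fin n)) =
          1 - 2 * ((k : ℝ) - 1) / ((n : ℝ) * ((n : ℝ) - 1))) ∧
    (∀ k k' : ℕ, 2 ≤ k → k < k' → k' ≤ n → ∀ i j : Fin n, j < i →
        lam k' ({(i, j)} : Finset (Fin n × Fin n)) <
          lam k ({(i, j)} : Finset (Fin n × Fin n))) ∧
    (∀ k k' : ℕ, 2 ≤ k → k < k' → k' ≤ n →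
      ∀ (I : Finset (Fin n × Fin n)) (i j : Fin n), j < i → (i, j) ∈ I →
        linkedSet I i = {j} → linkedSet I j = {i} →
        lam k' I ≤ lam k I) := by
  refine ⟨fun k _ hk i => lam_action k hk hn i, fun k h1 hk i j hij => lam_link k h1 hk i j hij,
    fun k k' h2 hlt hk i j hij => ?_,
    fun k k' _ hlt hk I i j _ _ _ _ => lam_anti k k' hlt.le hk I⟩
  rw [lam_link k (by omega) (by omega) i j hij, lam_link k' (by omega) hk i j hij]
  have hn' : (2 : ℝ) ≤ n := by exact_mod_cast hn
  have hlt' : (k : ℝ) < k' := by exact_mod_cast hlt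
  have hpos : (0 : ℝ) < (n : ℝ) * ((n : ℝ) - 1) := mul_pos (by linarith) (by linarith)
  have := div_lt_div_of_pos_right (show 2 * ((k : ℝ) - 1) < 2 * ((k' : ℝ) - 1) by linarith) hpos
  linarith

end NEkSN
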